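/- arXiv:1305.3449 — 3 statements merged into one kernel-verified Lean document; each statement's English description precedes it below -/
import Mathlib

section
/- The map f ↦ 1−f is an orthocomplementation on the logic L: for every f ∈ L the functional 1−f belongs to L, 1−(1−f) = f, and f ≤ g implies 1−g ≤ 1−f; moreover, every g ∈ L with g(P) ≤ f(P) and g(P) ≤ 1−f(P) for all P ∈ S is the constant 0 functional, and every h ∈ L with f(P) ≤ h(P) and 1−f(P) ≤ h(P) for all P ∈ S is the constant 1 functional (so f ∧ (1−f) = 0 and f ∨ (1−f) = 1 in L). -/
namespace BoxWorld

/-- A (2,2)-box assignment: `P a b α β` stands for `P(αβ|ab)`, where the measurement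
settings are `a, b ∈ Fin 2` (with `x = 0`, `y = 1`) and the outcomes are `α, β ∈ Fin 2`. -/
abbrev Box : Type := Fin 2 → Fin 2 → Fin 2 → Fin 2 → ℝ

/-- (P1) positivity, (P2) normalization, (P3) non-signalling. -/
def IsState (P : Box) : Prop :=
  (∀ a b α β, 0 ≤ P a b α β) ∧
  (∀ a b, ∑ α : Fin 2, ∑ β : Fin 2, P a b α β = 1) ∧
  (∀ a b b' α, ∑ β : Fin 2, P a b α β = ∑ β : Fin 2, P a b' α β) ∧
  (∀ a a' b β, ∑ α : Fin 2, P a b α β = ∑ α : Fin 2, P a' b α β)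

/-- The set `S` of (2,2)-box states, as a subtype. -/
abbrev State : Type := {P : Box // IsState P}

/-- The elementary question `e[ab, αβ]`, as a functional on states. -/
def elem (a b α β : Fin 2) : State → ℝ := fun P => P.1 a b α β

abbrev Idx : Type := Fin 2 × Fin 2 × Fin 2 × Fin 2

def elemI (i : Idx) : State → ℝ := elem i.1 i.2.1 i.2.2.1 i.2.2.2

/-- The logic `L` of the (2,2)-box world: all functionals `f = Σ_{e ∈ A} e`, where `A` is a
set of elementary questions whose pointwise sum is `≤ 1` at every state, together with the
complements `1 - f` of all such functionals. -/
def InLogic (f : State → ℝ) : Prop :=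
  (∃ A : Finset Idx, (∀ P : State, ∑ i ∈ A, elemI i P ≤ 1) ∧
      f = fun P => ∑ i ∈ A, elemI i P) ∨
  (∃ A : Finset Idx, (∀ P : State, ∑ i ∈ A, elemI i P ≤ 1) ∧
      f = fun P => 1 - ∑ i ∈ A, elemI i P)

/-- The deterministic box with response functions `x` and `y`. -/
def detBox (x y : Fin 2 → Fin 2) : Box :=
  fun a b α β => if x a = α ∧ y b = β then 1 else 0

lemma isState_detBox (x y : Fin 2 → Fin 2) : IsState (detBox x y) := by
  refine ⟨fun a b α β => ?_, fun a b => ?_, fun a b b' α => ?_, fun a a' b β => ?_⟩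
  · unfold detBox; split_ifs <;> norm_num
  all_goals simp [detBox, ite_and]

def detState (x y : Fin 2 → Fin 2) : State := ⟨detBox x y, isState_detBox x y⟩

/-- Coefficients of an affine decomposition of a box into deterministic boxes. -/
noncomputable def detCoeff (P : Box) (x y : Fin 2 → Fin 2) : ℝ :=
  (∑ a, ∑ b, P a b (x a) (y b)) / 4 - (∑ a, ∑ β, P a 0 (x a) β) / 8
    - (∑ b, ∑ α, P 0 b α (y b)) / 8 + 1 / 16

lemma sum_fin_two_fun (F : (Fin 2 → Fin 2) → ℝ) :
    ∑ x, F x = F ![0, 0] + F ![0, 1] + F ![1, 0] + F ![1, 1] := by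
  rw [← (finTwoArrowEquiv (Fin 2)).symm.sum_comp, Fintype.sum_prod_type]
  simp [finTwoArrowEquiv, ← add_assoc]

lemma sum_detCoeff {P : Box} (hP : IsState P) : ∑ x, ∑ y, detCoeff P x y = 1 := by
  obtain ⟨-, h2, h3, h4⟩ := hP
  simp only [sum_fin_two_fun, detCoeff, Fin.sum_univ_two, Matrix.cons_val_zero,
    Matrix.cons_val_one] at *
  linarith [h2 0 0, h2 0 1, h2 1 0, h2 1 1]

lemma sum_detCoeff_mul {P : Box} (hP : IsState P) (a b α β : Fin 2) :
    ∑ x, ∑ y, detCoeff P x y * detBox x y a b α β = P a b α β := by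
  obtain ⟨-, h2, h3, h4⟩ := hP
  simp only [sum_fin_two_fun, detCoeff, detBox, Fin.sum_univ_two, Matrix.cons_val_zero,
    Matrix.cons_val_one] at *
  have n00 := h2 0 0
  have n01 := h2 0 1
  have n10 := h2 1 0
  have n11 := h2 1 1
  have r00 := h3 0 0 1 0
  have r01 := h3 0 0 1 1
  have r10 := h3 1 0 1 0
  have r11 := h3 1 0 1 1
  have c00 := h4 0 1 0 0
  have c01 := h4 0 1 0 1
  have c10 := h4 0 1 1 0
  have c11 := h4 0 1 1 1
  fin_cases a <;> fin_cases b <;> fin_cases α <;> fin_cases β <;> simp <;> linarith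

lemma sum_elemI_eq (A : Finset Idx) (P : State) :
    ∑ i ∈ A, elemI i P =
      ∑ x, ∑ y, detCoeff P.1 x y * ∑ i ∈ A, elemI i (detState x y) := by
  simp only [Finset.mul_sum]
  simp_rw [Finset.sum_comm (t := A)]
  exact Finset.sum_congr rfl fun i _ =>
    (sum_detCoeff_mul P.2 i.1 i.2.1 i.2.2.1 i.2.2.2).symm

lemma InLogic.eq_sum_det {g : State → ℝ} (hg : InLogic g) (P : State) :
    g P = ∑ x, ∑ y, detCoeff P.1 x y * g (detState x y) := by
  rcases hg with ⟨A, -, rfl⟩ | ⟨A, -, rfl⟩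
  · exact sum_elemI_eq A P
  · simp only [mul_sub, mul_one, Finset.sum_sub_distrib, sum_detCoeff P.2]
    rw [← sum_elemI_eq A P]

lemma sum_elemI_det {A : Finset Idx} (hA : ∀ P : State, ∑ i ∈ A, elemI i P ≤ 1)
    (x y : Fin 2 → Fin 2) :
    ∑ i ∈ A, elemI i (detState x y) = 0 ∨ ∑ i ∈ A, elemI i (detState x y) = 1 := by
  have h := hA (detState x y)
  simp only [elemI, elem, detState, detBox, Finset.sum_boole] at h ⊢
  norm_cast at h ⊢
  omega

lemma InLogic.det_eq {g : State → ℝ} (hg : InLogic g) (x y : Fin 2 → Fin 2) :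
    g (detState x y) = 0 ∨ g (detState x y) = 1 := by
  rcases hg with ⟨A, hA, rfl⟩ | ⟨A, hA, rfl⟩ <;>
    rcases sum_elemI_det hA x y with h | h <;> simp [h]

lemma InLogic.compl {f : State → ℝ} (hf : InLogic f) : InLogic fun P => 1 - f P := by
  rcases hf with ⟨A, hA, rfl⟩ | ⟨A, hA, rfl⟩
  · exact Or.inr ⟨A, hA, rfl⟩
  · exact Or.inl ⟨A, hA, by simp⟩

lemma InLogic.eq_zero_of_le {f g : State → ℝ} (hf : InLogic f) (hg : InLogic g)
    (h : ∀ P, g P ≤ f P) (h' : ∀ P, g P ≤ 1 - f P) : g = fun _ => 0 := by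
  have hdet (x y) : g (detState x y) = 0 := by
    have h₁ := h (detState x y)
    have h₂ := h' (detState x y)
    rcases hg.det_eq x y with h₃ | h₃ <;> rcases hf.det_eq x y with h₄ | h₄ <;> linarith
  funext P
  simp [hg.eq_sum_det P, hdet]

/-- `f ↦ 1 − f` is an orthocomplementation on the logic `L`. -/
theorem orthocomplementation (f : State → ℝ) (hf : InLogic f) :
    InLogic (fun P => 1 - f P) ∧
    (fun P => 1 - (1 - f P)) = f ∧
    (∀ g : State → ℝ, InLogic g → (∀ P : State, f P ≤ g P) →
      ∀ P : State, 1 - g P ≤ 1 - f P) ∧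
    (∀ g : State → ℝ, InLogic g → (∀ P : State, g P ≤ f P) →
      (∀ P : State, g P ≤ 1 - f P) → g = fun _ => 0) ∧
    (∀ h : State → ℝ, InLogic h → (∀ P : State, f P ≤ h P) →
      (∀ P : State, 1 - f P ≤ h P) → h = fun _ => 1) := by
  refine ⟨hf.compl, by simp, fun g _ h P => by linarith [h P],
    fun g hg h h' => hf.eq_zero_of_le hg h h', fun g hg h h' => ?_⟩
  have key := hf.eq_zero_of_le hg.compl (fun P => by linarith [h' P])
    (fun P => by linarith [h P])
  funext P
  linarith [congrFun key P]

end BoxWorld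
end

section
/- The logic L of the (2,2)-box world, regarded as a set of real-valued functionals on S, has exactly 82 elements. -/
namespace BoxWorld

/-- The deterministic box in which setting `a` of the first party yields `x a` and setting `b` of
the second party yields `y b`. -/
def deterministicState (x y : Fin 2 → Fin 2) : State :=
  ⟨fun a b α β => if x a = α ∧ y b = β then 1 else 0, by
    refine ⟨fun a b α β => ?_, fun a b => ?_, fun a b b' α => ?_, fun a a' b β => ?_⟩
    · dsimp only; split_ifs <;> norm_num
    · simp [ite_and]
    · simp [ite_and]
    · simp [ite_and]⟩

lemma elemI_deterministicState (i : Idx) (x y : Fin 2 → Fin 2) :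
    elemI i (deterministicState x y) = if x i.1 = i.2.2.1 ∧ y i.2.1 = i.2.2.2 then 1 else 0 :=
  rfl

/-- The local strategy that answers `0` at most at one setting. -/
def answers (s : Option (Fin 2)) (a : Fin 2) : Fin 2 := if s = some a then 0 else 1

abbrev Strategy : Type := Option (Fin 2) × Option (Fin 2)

/-- The coefficients of a state as an affine combination of the nine deterministic states
`deterministicState (answers s) (answers t)`. -/
def weight (P : State) : Strategy → ℝ
  | (some a, some b) => P.1 a b 0 0
  | (some a, none) => P.1 a 0 0 1 - P.1 a 1 0 0
  | (none, some b) => P.1 0 b 1 0 - P.1 1 b 0 0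
  | (none, none) => 1 - ∑ a, (P.1 a 0 0 1 - P.1 a 1 0 0) - ∑ b, (P.1 0 b 1 0 - P.1 1 b 0 0)
      - ∑ a, ∑ b, P.1 a b 0 0

/-- The functional taking prescribed values at the nine deterministic states. -/
def interpolate (v : Strategy → ℕ) : State → ℝ := fun P => ∑ k, weight P k * v k

lemma weight_deterministicState (k l : Strategy) :
    weight (deterministicState (answers k.1) (answers k.2)) l = if l = k then 1 else 0 := by
  revert k l
  simp [weight, deterministicState, answers, Prod.forall, Option.forall, Fin.forall_fin_two,
    Finset.filter_eq]

lemma interpolate_injective : Function.Injective interpolate := by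
  intro v w h
  funext k
  have := congrFun h (deterministicState (answers k.1) (answers k.2))
  simpa [interpolate, weight_deterministicState] using this

lemma elemI_eq_sum_weight (i : Idx) (P : State) :
    elemI i P = ∑ k : Strategy, weight P k *
      if answers k.1 i.1 = i.2.2.1 ∧ answers k.2 i.2.1 = i.2.2.2 then 1 else 0 := by
  obtain ⟨P, -, norm, left, right⟩ := P
  obtain ⟨a, b, α, β⟩ := i
  simp only [Fin.sum_univ_two] at norm left right
  have n00 := norm 0 0
  have n01 := norm 0 1
  have n10 := norm 1 0
  have n11 := norm 1 1
  have l0 := left 0 0 1 0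
  have l1 := left 1 0 1 0
  have r0 := right 0 1 0 0
  have r1 := right 0 1 1 0
  fin_cases a <;> fin_cases b <;> fin_cases α <;> fin_cases β <;>
    simp [elemI, elem, weight, answers, Fintype.sum_prod_type, Fin.sum_univ_two] <;> linarith

/-- The values of a sum of elementary questions at the nine deterministic states. -/
def profile (A : Finset Idx) : Strategy → ℕ := fun k =>
  ∑ i ∈ A, if answers k.1 i.1 = i.2.2.1 ∧ answers k.2 i.2.1 = i.2.2.2 then 1 else 0

lemma sum_elemI_eq_interpolate (A : Finset Idx) :
    (fun P => ∑ i ∈ A, elemI i P) = interpolate (profile A) := by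
  funext P
  simp only [elemI_eq_sum_weight, interpolate, profile, Nat.cast_sum, Finset.mul_sum]
  rw [Finset.sum_comm]
  simp

/-- The outcomes of the measurement in which the first party chooses setting `a` and the second
party, told the outcome `α`, chooses `g α`. -/
def leftTest (a : Fin 2) (g : Fin 2 → Fin 2) : Finset Idx :=
  Finset.univ.image fun o : Fin 2 × Fin 2 => (a, g o.1, o.1, o.2)

/-- The outcomes of the measurement in which the second party chooses setting `b` and the first
party, told the outcome `β`, chooses `g β`. -/
def rightTest (b : Fin 2) (g : Fin 2 → Fin 2) : Finset Idx :=
  Finset.univ.image fun o : Fin 2 × Fin 2 => (g o.2, b, o.1, o.2)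

def tests : Finset (Finset Idx) :=
  Finset.univ.image (fun m : Fin 2 × (Fin 2 → Fin 2) => leftTest m.1 m.2) ∪
    Finset.univ.image (fun m : Fin 2 × (Fin 2 → Fin 2) => rightTest m.1 m.2)

lemma mem_tests {T : Finset Idx} :
    T ∈ tests ↔ (∃ a g, leftTest a g = T) ∨ ∃ b g, rightTest b g = T := by
  simp [tests]

lemma sum_elemI_of_mem_tests {T : Finset Idx} (hT : T ∈ tests) (P : State) :
    ∑ i ∈ T, elemI i P = 1 := by
  obtain ⟨P, -, norm, left, right⟩ := P
  rcases mem_tests.1 hT with ⟨a, g, rfl⟩ | ⟨b, g, rfl⟩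
  · rw [leftTest, Finset.sum_image (by rintro ⟨_, _⟩ _ ⟨_, _⟩ _; simp_all), Fintype.sum_prod_type]
    calc ∑ α, ∑ β, P a (g α) α β = ∑ α, ∑ β, P a 0 α β :=
          Finset.sum_congr rfl fun α _ => left a (g α) 0 α
      _ = 1 := norm a 0
  · rw [rightTest, Finset.sum_image (by rintro ⟨_, _⟩ _ ⟨_, _⟩ _; simp_all),
      Fintype.sum_prod_type_right]
    calc ∑ β, ∑ α, P (g β) b α β = ∑ β, ∑ α, P 0 b α β :=
          Finset.sum_congr rfl fun β _ => right (g β) 0 b β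
      _ = 1 := by rw [Finset.sum_comm]; exact norm 0 b

/-- Distinct elementary questions that can never both be certain are excluded by one party. -/
lemma exclusive_of_sum_le_one {A : Finset Idx} (hA : ∀ P : State, ∑ i ∈ A, elemI i P ≤ 1)
    {i j : Idx} (hi : i ∈ A) (hj : j ∈ A) (hij : i ≠ j) :
    (i.1 = j.1 ∧ i.2.2.1 ≠ j.2.2.1) ∨ (i.2.1 = j.2.1 ∧ i.2.2.2 ≠ j.2.2.2) := by
  by_contra! h
  obtain ⟨hα, hβ⟩ := h
  set P := deterministicState (fun a => if a = i.1 then i.2.2.1 else j.2.2.1)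
    (fun b => if b = i.2.1 then i.2.2.2 else j.2.2.2) with hP
  have h₁ : elemI i P = 1 := by simp [hP, elemI_deterministicState]
  have h₂ : elemI j P = 1 := by
    rw [hP, elemI_deterministicState, if_pos]
    constructor
    · split_ifs with h
      exacts [hα h.symm, rfl]
    · split_ifs with h
      exacts [hβ h.symm, rfl]
  have hle : ∑ k ∈ {i, j}, elemI k P ≤ ∑ k ∈ A, elemI k P :=
    Finset.sum_le_sum_of_subset_of_nonneg (by simp [Finset.insert_subset_iff, hi, hj])
      fun k _ _ => P.2.1 _ _ _ _
  rw [Finset.sum_pair hij] at hle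
  linarith [hA P]

/-- Pairwise exclusive elementary questions are outcomes of a common measurement. -/
lemma exists_test_of_sum_le_one {A : Finset Idx}
    (hA : ∀ P : State, ∑ i ∈ A, elemI i P ≤ 1) : ∃ T ∈ tests, A ⊆ T := by
  have excl : ∀ i ∈ A, ∀ j ∈ A, i ≠ j →
      (i.1 = j.1 ∧ i.2.2.1 ≠ j.2.2.1) ∨ (i.2.1 = j.2.1 ∧ i.2.2.2 ≠ j.2.2.2) :=
    fun i hi j hj hij => exclusive_of_sum_le_one hA hi hj hij
  by_cases ha : ∃ a, ∀ i ∈ A, i.1 = a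
  · obtain ⟨a, ha⟩ := ha
    have : ∀ α : Fin 2, ∃ b, ∀ i ∈ A, i.2.2.1 = α → i.2.1 = b := by
      intro α
      by_cases h : ∃ j ∈ A, j.2.2.1 = α
      · obtain ⟨j, hj, rfl⟩ := h
        refine ⟨j.2.1, fun i hi hα => ?_⟩
        by_cases hij : i = j
        · rw [hij]
        · exact ((excl i hi j hj hij).resolve_left fun h => h.2 hα).1
      · exact ⟨0, fun i hi hα => (h ⟨i, hi, hα⟩).elim⟩
    choose g hg using this
    refine ⟨leftTest a g, mem_tests.2 (.inl ⟨a, g, rfl⟩), fun i hi => ?_⟩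
    simp only [leftTest, Finset.mem_image, Finset.mem_univ, true_and]
    exact ⟨i.2.2, by rw [← hg _ i hi rfl, ← ha i hi]⟩
  · have hb : ∃ b, ∀ i ∈ A, i.2.1 = b := by
      push Not at ha
      obtain ⟨i, hi, hi0⟩ := ha 0
      obtain ⟨j, hj, hj1⟩ := ha 1
      have cross : ∀ k ∈ A, ∀ l ∈ A, k.1 ≠ l.1 → k.2.1 = l.2.1 := fun k hk l hl h =>
        ((excl k hk l hl fun e => h (by rw [e])).resolve_left fun e => h e.1).1
      have hij : i.2.1 = j.2.1 := cross i hi j hj (by omega)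
      refine ⟨i.2.1, fun k hk => ?_⟩
      by_cases hk0 : k.1 = i.1
      · rw [hij]; exact cross k hk j hj (by omega)
      · exact cross k hk i hi hk0
    obtain ⟨b, hb⟩ := hb
    have : ∀ β : Fin 2, ∃ a, ∀ i ∈ A, i.2.2.2 = β → i.1 = a := by
      intro β
      by_cases h : ∃ j ∈ A, j.2.2.2 = β
      · obtain ⟨j, hj, rfl⟩ := h
        refine ⟨j.1, fun i hi hβ => ?_⟩
        by_cases hij : i = j
        · rw [hij]
        · exact ((excl i hi j hj hij).resolve_right fun h => h.2 hβ).1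
      · exact ⟨0, fun i hi hβ => (h ⟨i, hi, hβ⟩).elim⟩
    choose g hg using this
    refine ⟨rightTest b g, mem_tests.2 (.inr ⟨b, g, rfl⟩), fun i hi => ?_⟩
    simp only [rightTest, Finset.mem_image, Finset.mem_univ, true_and]
    exact ⟨i.2.2, by rw [← hg _ i hi rfl, ← hb i hi]⟩

lemma inLogic_iff_exists_subset_test (f : State → ℝ) :
    InLogic f ↔ ∃ A ∈ tests.biUnion Finset.powerset, f = fun P => ∑ i ∈ A, elemI i P := by
  simp only [Finset.mem_biUnion, Finset.mem_powerset]
  constructor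
  · rintro (⟨A, hA, rfl⟩ | ⟨A, hA, rfl⟩) <;> obtain ⟨T, hT, hAT⟩ := exists_test_of_sum_le_one hA
    · exact ⟨A, ⟨T, hT, hAT⟩, rfl⟩
    · refine ⟨T \ A, ⟨T, hT, Finset.sdiff_subset⟩, funext fun P => ?_⟩
      rw [← sum_elemI_of_mem_tests hT P, ← Finset.sum_sdiff hAT, add_sub_cancel_right]
  · rintro ⟨A, ⟨T, hT, hAT⟩, rfl⟩
    refine .inl ⟨A, fun P => ?_, rfl⟩
    rw [← sum_elemI_of_mem_tests hT P]
    exact Finset.sum_le_sum_of_subset_of_nonneg hAT fun k _ _ => P.2.1 _ _ _ _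

lemma card_image_profile : ((tests.biUnion Finset.powerset).image profile).card = 82 := by
  decide +kernel

/-- the logic `L` of the (2,2)-box world, regarded as a set of real-valued
functionals on the state space `S`, has exactly 82 elements. -/
theorem logic_has_82_elements :
    Set.ncard {f : State → ℝ | InLogic f} = 82 := by
  have h : {f : State → ℝ | InLogic f} =
      interpolate '' ((tests.biUnion Finset.powerset).image profile : Finset _) := by
    ext f
    simp [inLogic_iff_exists_subset_test, sum_elemI_eq_interpolate, eq_comm (a := f)]
  rw [h, Set.ncard_image_of_injective _ interpolate_injective, Set.ncard_coe_finset,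
    card_image_profile]

end BoxWorld
end

section
/- The (2,2)-box states defined by (P1)–(P3) are exactly the probability measures on the logic L: for every function μ : L → ℝ satisfying 0 ≤ μ(f) ≤ 1 for all f ∈ L, μ(0) = 0, μ(1) = 1, and μ(h) = μ(f) + μ(g) whenever f, g, h ∈ L with h(P) = f(P) + g(P) for all P ∈ S, there exists a unique (2,2)-box state P₀ ∈ S such that μ(f) = f(P₀) for all f ∈ L; conversely, for every P₀ ∈ S the map f ↦ f(P₀) is such a function. -/
namespace BoxWorld

/-- The pointwise sum of a set of elementary questions. -/
def questionSum (A : Finset Idx) : State → ℝ := fun P => ∑ i ∈ A, elemI i P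

/-- A set of elementary questions is admissible if its pointwise sum is at most one. -/
def Admissible (A : Finset Idx) : Prop := ∀ P, questionSum A P ≤ 1

/-- The outcomes of a joint measurement of `a` and `b`, with outcomes in the given sets. -/
def questions (a b : Fin 2) (s t : Finset (Fin 2)) : Finset Idx :=
  {a} ×ˢ {b} ×ˢ s ×ˢ t

lemma elemI_nonneg (i : Idx) (P : State) : 0 ≤ elemI i P := P.2.1 _ _ _ _

lemma questionSum_nonneg (A : Finset Idx) (P : State) : 0 ≤ questionSum A P :=
  Finset.sum_nonneg fun i _ => elemI_nonneg i P

lemma Admissible.mono {A B : Finset Idx} (hB : Admissible B) (h : A ⊆ B) : Admissible A :=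
  fun P => (Finset.sum_le_sum_of_subset_of_nonneg h fun i _ _ => elemI_nonneg i P).trans (hB P)

lemma Admissible.inLogic {A : Finset Idx} (hA : Admissible A) : InLogic (questionSum A) :=
  Or.inl ⟨A, hA, rfl⟩

lemma Admissible.inLogic_compl {A : Finset Idx} (hA : Admissible A) :
    InLogic (fun P => 1 - questionSum A P) :=
  Or.inr ⟨A, hA, rfl⟩

lemma admissible_empty : Admissible ∅ := fun P => by simp [questionSum]

lemma inLogic_one : InLogic (fun _ => 1) := by
  simpa [questionSum] using admissible_empty.inLogic_compl

lemma sum_questions (a b : Fin 2) (s t : Finset (Fin 2)) (F : Idx → ℝ) :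
    ∑ i ∈ questions a b s t, F i = ∑ α ∈ s, ∑ β ∈ t, F (a, b, α, β) := by
  simp [questions, Finset.sum_product]

lemma questionSum_questions_univ (a b : Fin 2) :
    questionSum (questions a b Finset.univ Finset.univ) = fun _ => 1 :=
  funext fun P => (sum_questions a b _ _ _).trans (P.2.2.1 a b)

lemma admissible_questions (a b : Fin 2) (s t : Finset (Fin 2)) :
    Admissible (questions a b s t) := by
  have h : Admissible (questions a b Finset.univ Finset.univ) := fun P => by
    rw [questionSum_questions_univ]
  refine h.mono fun i hi => ?_
  simp only [questions, Finset.mem_product, Finset.mem_univ, and_true] at hi ⊢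
  exact ⟨hi.1, hi.2.1⟩

lemma questionSum_left_marginal (a b b' α : Fin 2) :
    questionSum (questions a b {α} Finset.univ) =
      questionSum (questions a b' {α} Finset.univ) := by
  funext P
  simp only [questionSum, sum_questions, Finset.sum_singleton]
  exact P.2.2.2.1 a b b' α

lemma questionSum_right_marginal (a a' b β : Fin 2) :
    questionSum (questions a b Finset.univ {β}) =
      questionSum (questions a' b Finset.univ {β}) := by
  funext P
  simp only [questionSum, sum_questions, Finset.sum_singleton]
  exact P.2.2.2.2 a a' b β

lemma admissible_singleton (i : Idx) : Admissible {i} := by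
  simpa [questions] using admissible_questions i.1 i.2.1 {i.2.2.1} {i.2.2.2}

lemma questionSum_singleton (i : Idx) : questionSum {i} = elemI i := by
  funext P
  simp [questionSum]

lemma inLogic_elemI (i : Idx) : InLogic (elemI i) :=
  questionSum_singleton i ▸ (admissible_singleton i).inLogic

lemma InLogic.mem_unitInterval {f : State → ℝ} (hf : InLogic f) (P : State) :
    0 ≤ f P ∧ f P ≤ 1 := by
  obtain ⟨A, hA, rfl⟩ | ⟨A, hA, rfl⟩ := hf
  · exact ⟨questionSum_nonneg A P, hA P⟩
  · exact ⟨sub_nonneg.2 (hA P), sub_le_self _ (questionSum_nonneg A P)⟩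

section Measure

variable {μ : (State → ℝ) → ℝ}

/-- An additive function on the logic is additive on admissible sets of elementary questions. -/
lemma measure_questionSum (h0 : μ (fun _ => 0) = 0)
    (hadd : ∀ f g h : State → ℝ, InLogic f → InLogic g → InLogic h →
      (∀ P : State, h P = f P + g P) → μ h = μ f + μ g)
    {A : Finset Idx} (hA : Admissible A) : μ (questionSum A) = ∑ i ∈ A, μ (elemI i) := by
  induction A using Finset.induction_on with
  | empty => exact h0
  | insert i A hi ih =>
    have hA' := hA.mono (Finset.subset_insert i A)
    rw [Finset.sum_insert hi, ← ih hA']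
    exact hadd _ _ _ (inLogic_elemI i) hA'.inLogic hA.inLogic fun P => Finset.sum_insert hi

/-- The values of a probability measure at the elementary questions form a state. -/
lemma isState_of_measure (hμ : ∀ f : State → ℝ, InLogic f → 0 ≤ μ f ∧ μ f ≤ 1)
    (h0 : μ (fun _ => 0) = 0) (h1 : μ (fun _ => 1) = 1)
    (hadd : ∀ f g h : State → ℝ, InLogic f → InLogic g → InLogic h →
      (∀ P : State, h P = f P + g P) → μ h = μ f + μ g) :
    IsState fun a b α β => μ (elem a b α β) := by
  have key (a b : Fin 2) (s t : Finset (Fin 2)) :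
      μ (questionSum (questions a b s t)) = ∑ α ∈ s, ∑ β ∈ t, μ (elem a b α β) :=
    (measure_questionSum h0 hadd (admissible_questions a b s t)).trans (sum_questions a b s t _)
  refine ⟨fun a b α β => (hμ _ (inLogic_elemI (a, b, α, β))).1, fun a b => ?_,
    fun a b b' α => ?_, fun a a' b β => ?_⟩
  · rw [← key, questionSum_questions_univ, h1]
  · have h := congrArg μ (questionSum_left_marginal a b b' α)
    simpa only [key, Finset.sum_singleton] using h
  · have h := congrArg μ (questionSum_right_marginal a a' b β)
    simpa only [key, Finset.sum_singleton] using h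

end Measure

/-- the (2,2)-box states are exactly the probability measures on the logic
`L`: every finitely additive normalized `[0,1]`-valued function on `L` is evaluation at a
unique (2,2)-box state, and conversely evaluation at any (2,2)-box state is such a
function. -/
theorem states_are_probability_measures :
    (∀ μ : (State → ℝ) → ℝ,
      (∀ f : State → ℝ, InLogic f → 0 ≤ μ f ∧ μ f ≤ 1) →
      μ (fun _ => 0) = 0 →
      μ (fun _ => 1) = 1 →
      (∀ f g h : State → ℝ, InLogic f → InLogic g → InLogic h →
        (∀ P : State, h P = f P + g P) → μ h = μ f + μ g) →
      ∃! P₀ : State, ∀ f : State → ℝ, InLogic f → μ f = f P₀) ∧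
    (∀ P₀ : State,
      (∀ f : State → ℝ, InLogic f → 0 ≤ f P₀ ∧ f P₀ ≤ 1) ∧
      ((fun _ : State => (0:ℝ)) P₀ = 0) ∧
      ((fun _ : State => (1:ℝ)) P₀ = 1) ∧
      (∀ f g h : State → ℝ, InLogic f → InLogic g → InLogic h →
        (∀ P : State, h P = f P + g P) → h P₀ = f P₀ + g P₀)) := by
  refine ⟨fun μ hμ h0 h1 hadd => ?_, fun P₀ => ⟨fun f hf => hf.mem_unitInterval P₀, rfl, rfl,
    fun f g h _ _ _ H => H P₀⟩⟩
  refine ⟨⟨_, isState_of_measure hμ h0 h1 hadd⟩, ?_, fun Q hQ => ?_⟩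
  · rintro f (⟨A, hA, rfl⟩ | ⟨A, hA, rfl⟩)
    · exact measure_questionSum h0 hadd hA
    · have hA' : Admissible A := hA
      have h := hadd _ _ _ hA'.inLogic hA'.inLogic_compl inLogic_one
        fun P => (add_sub_cancel _ _).symm
      rw [h1, measure_questionSum h0 hadd hA'] at h
      exact eq_sub_of_add_eq' h.symm
  · refine Subtype.ext ?_
    funext a b α β
    exact (hQ _ (inLogic_elemI (a, b, α, β))).symm

end BoxWorld
end
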